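/- Let U be an update family with S(U) ≠ S¹. Then there exists p < 1 such that ℙ_p([A] = ℤ²) = 1; that is, p_c(ℤ², U) < 1. -/

import Mathlib

open Set MeasureTheory

/-- A site of the two-dimensional lattice. -/
abbrev Site : Type := ℤ × ℤ

/-- One step of the `U`-bootstrap process. -/
def bsStep (U : Finset (Finset Site)) (A : Set Site) : Set Site :=
  A ∪ {x : Site | ∃ X ∈ U, ∀ y ∈ X, y + x ∈ A}

/-- The `t`-th stage of the `U`-bootstrap process started from `A`. -/
def bsIter (U : Finset (Finset Site)) : ℕ → Set Site → Set Site
  | 0, A => A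
  | n + 1, A => bsStep U (bsIter U n A)

/-- The closure `[A]` under the `U`-bootstrap process. -/
def bsClosure (U : Finset (Finset Site)) (A : Set Site) : Set Site :=
  ⋃ n : ℕ, bsIter U n A

/-- `U` is an update family: a (finite) collection of finite nonempty subsets of `ℤ² \ {0}`. -/
def IsUpdateFamily (U : Finset (Finset Site)) : Prop :=
  U.Nonempty ∧ ∀ X ∈ U, X.Nonempty ∧ (0 : Site) ∉ X

/-- The discrete half-plane `H_u` determined by `u ∈ ℝ²`. -/
def halfPlane (u : ℝ × ℝ) : Set Site :=
  {x : Site | (x.1 : ℝ) * u.1 + (x.2 : ℝ) * u.2 < 0}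

/-- A direction `u` is stable for `U` if `[H_u] = H_u`. -/
def IsStableDir (U : Finset (Finset Site)) (u : ℝ × ℝ) : Prop :=
  bsClosure U (halfPlane u) = halfPlane u

/-- The unit vector of angle `θ`. -/
noncomputable def dir (θ : ℝ) : ℝ × ℝ := (Real.cos θ, Real.sin θ)

/-- `dir θ` lies in the interior of the stable set (is strongly stable). -/
def IsStronglyStableAngle (U : Finset (Finset Site)) (θ : ℝ) : Prop :=
  ∃ ε > 0, ∀ φ : ℝ, |φ - θ| < ε → IsStableDir U (dir φ)

/-- `U` is subcritical: every open semicircle contains a strongly stable direction. -/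
def Subcritical (U : Finset (Finset Site)) : Prop :=
  ∀ θ : ℝ, ∃ φ : ℝ, θ < φ ∧ φ < θ + Real.pi ∧ IsStronglyStableAngle U φ

/-- `U` is supercritical: some open semicircle contains no stable direction. -/
def Supercritical (U : Finset (Finset Site)) : Prop :=
  ∃ θ : ℝ, ∀ φ : ℝ, θ < φ → φ < θ + Real.pi → ¬ IsStableDir U (dir φ)

/-- The random set of infected sites determined by `ω`. -/
def siteSet (ω : Site → Bool) : Set Site := {x : Site | ω x = true}

/-- `μ` is the Bernoulli product measure with density `p` on `ℤ²`:
each site lies in the random set independently with probability `p`. -/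
def IsBernoulli (p : ℝ) (μ : Measure (Site → Bool)) : Prop :=
  ∀ (s : Finset Site) (f : Site → Bool),
    μ {ω : Site → Bool | ∀ x ∈ s, ω x = f x}
      = ∏ x ∈ s, ENNReal.ofReal (if f x then p else 1 - p)

/-- `A` percolates: its closure is all of `ℤ²`. -/
def Percolates (U : Finset (Finset Site)) (A : Set Site) : Prop :=
  bsClosure U A = Set.univ

/-- The critical probability `p_c(ℤ², U)`. -/
noncomputable def critProb (U : Finset (Finset Site)) : ℝ :=
  sInf {p : ℝ | p ∈ Set.Icc (0 : ℝ) 1 ∧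
    ∀ μ : Measure (Site → Bool), IsBernoulli p μ →
      μ {ω : Site → Bool | Percolates U (siteSet ω)} = 1}

/-- Euclidean embedding of the lattice into the complex plane. -/
noncomputable def toC (v : Site) : ℂ := ⟨(v.1 : ℝ), (v.2 : ℝ)⟩

/-- The range `r(U)`: the largest Euclidean distance between two sites of one update rule. -/
noncomputable def famRange (U : Finset (Finset Site)) : ℝ :=
  (U.sup fun X => X.sup fun a => X.sup fun b => nndist (toC a) (toC b) : NNReal)

theorem subset_bsIter (U : Finset (Finset Site)) (A : Set Site) (n : ℕ) : A ⊆ bsIter U n A := by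
  induction n with
  | zero => exact subset_rfl
  | succ n ih => exact ih.trans subset_union_left

/-- An unstable direction admits a rule contained in the corresponding open half-plane. -/
theorem exists_rule_subset_halfPlane {U : Finset (Finset Site)} {u : ℝ × ℝ}
    (h : ¬ IsStableDir U u) : ∃ X ∈ U, ∀ y ∈ X, y ∈ halfPlane u := by
  by_contra! hX
  refine h (subset_antisymm (iUnion_subset fun n => ?_)
    (subset_iUnion (fun n => bsIter U n (halfPlane u)) 0))
  induction n with
  | zero => exact subset_rfl
  | succ n ih =>
    rintro x (hx | ⟨X, hXU, hx⟩)
    · exact ih hx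
    · obtain ⟨y, hy, hyu⟩ := hX X hXU
      have hyx := ih (hx y hy)
      simp only [halfPlane, mem_ofPred_eq, Prod.fst_add, Prod.snd_add, Int.cast_add] at hyx hyu ⊢
      linarith

theorem IsBernoulli.measure_closed {p : ℝ} {μ : Measure (Site → Bool)} (h : IsBernoulli p μ)
    (s : Finset Site) :
    μ {ω | ∀ z ∈ s, ω z = false} = ENNReal.ofReal (1 - p) ^ s.card := by
  simpa using h s fun _ => false

/-- Given a rule inside an open half-plane, a site uninfected at time `n` starts a directed path of
`n + 1` closed sites; this is the corresponding first moment bound, for a path that continues a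
finite set `s` of closed sites lying ahead of `x`. -/
theorem IsBernoulli.measure_closed_inter_notMem_bsIter_le {p : ℝ} {μ : Measure (Site → Bool)}
    (h : IsBernoulli p μ) {U : Finset (Finset Site)} {X : Finset Site} (hXU : X ∈ U) {u : ℝ × ℝ}
    (hX : ∀ y ∈ X, y ∈ halfPlane u) (n : ℕ) (s : Finset Site) (x : Site)
    (hs : ∀ z ∈ s, x - z ∈ halfPlane u) :
    μ {ω | (∀ z ∈ s, ω z = false) ∧ x ∉ bsIter U n (siteSet ω)} ≤
      ENNReal.ofReal (1 - p) ^ (s.card + 1) * (X.card * ENNReal.ofReal (1 - p)) ^ n := by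
  have hxs : ∀ (s : Finset Site) (x : Site), (∀ z ∈ s, x - z ∈ halfPlane u) → x ∉ s :=
    fun s x hs hx => by simpa [halfPlane] using hs x hx
  induction n generalizing s x with
  | zero =>
    rw [pow_zero, mul_one, ← Finset.card_insert_of_notMem (hxs s x hs), ← h.measure_closed]
    refine measure_mono fun ω hω => ?_
    simpa [bsIter, siteSet, and_comm] using hω
  | succ n ih =>
    have hsub : {ω | (∀ z ∈ s, ω z = false) ∧ x ∉ bsIter U (n + 1) (siteSet ω)} ⊆
        ⋃ y ∈ X, {ω | (∀ z ∈ insert x s, ω z = false) ∧ y + x ∉ bsIter U n (siteSet ω)} := by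
      rintro ω ⟨hω, hx⟩
      have hx0 : ω x = false := by
        simpa [siteSet] using fun hx' => hx (subset_bsIter U _ (n + 1) hx')
      have hy : ∃ y ∈ X, y + x ∉ bsIter U n (siteSet ω) := by
        by_contra! hy
        exact hx (Or.inr ⟨X, hXU, hy⟩)
      obtain ⟨y, hyX, hy⟩ := hy
      exact mem_iUnion₂.2 ⟨y, hyX, by simpa using ⟨hx0, fun a b => hω (a, b)⟩, hy⟩
    refine (measure_mono hsub).trans ((measure_biUnion_finset_le X _).trans ?_)
    refine (Finset.sum_le_card_nsmul X _ _ fun y hy => ih (insert x s) (y + x) ?_).trans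
      (le_of_eq ?_)
    · intro z hz
      have hyu := hX y hy
      rcases Finset.mem_insert.1 hz with rfl | hz
      · simpa using hyu
      · have hzu := hs z hz
        simp only [halfPlane, mem_ofPred_eq, Prod.fst_add, Prod.snd_add, Prod.fst_sub, Prod.snd_sub,
          Int.cast_add, Int.cast_sub] at hyu hzu ⊢
        linarith
    · rw [Finset.card_insert_of_notMem (hxs s x hs), nsmul_eq_mul]
      ring

/-- Closed sites too sparse to percolate along a rule inside an open half-plane are all infected. -/
theorem IsBernoulli.measure_percolates_eq_one {p : ℝ} {μ : Measure (Site → Bool)}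
    (h : IsBernoulli p μ) {U : Finset (Finset Site)} {X : Finset Site} (hXU : X ∈ U) {u : ℝ × ℝ}
    (hX : ∀ y ∈ X, y ∈ halfPlane u) (hp : X.card * ENNReal.ofReal (1 - p) < 1) :
    μ {ω : Site → Bool | Percolates U (siteSet ω)} = 1 := by
  have huniv : μ univ = 1 := by simpa using h ∅ fun _ => false
  have hae : ∀ᵐ ω ∂μ, ∀ x, x ∈ bsClosure U (siteSet ω) := by
    refine ae_all_iff.2 fun x => ?_
    have hbound : ∀ n : ℕ, μ {ω | x ∉ bsClosure U (siteSet ω)} ≤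
        ENNReal.ofReal (1 - p) * (X.card * ENNReal.ofReal (1 - p)) ^ n := fun n => by
      have hn := h.measure_closed_inter_notMem_bsIter_le hXU hX n ∅ x (by simp)
      rw [Finset.card_empty, zero_add, pow_one] at hn
      refine le_trans (measure_mono fun ω hω => ?_) hn
      exact ⟨by simp, fun hx => hω (mem_iUnion.2 ⟨n, hx⟩)⟩
    have hlim := ENNReal.Tendsto.const_mul (ENNReal.tendsto_pow_atTop_nhds_zero_of_lt_one hp)
      (Or.inr (ENNReal.ofReal_ne_top (r := 1 - p)))
    rw [mul_zero] at hlim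
    exact le_antisymm (ge_of_tendsto' hlim hbound) zero_le
  rw [← huniv]
  refine measure_congr ?_
  filter_upwards [hae] with ω hω
  exact propext ⟨fun _ => trivial, fun _ => eq_univ_of_forall hω⟩

/-- Let `U` be an update family with `S(U) ≠ S¹`, i.e. some direction of
the unit circle is unstable. Then there exists `p < 1` such that `ℙ_p([A] = ℤ²) = 1`;
that is, `p_c(ℤ², U) < 1`. -/
theorem critProb_lt_one_of_unstable
    (U : Finset (Finset Site)) (hU : IsUpdateFamily U)
    (hS : ∃ u : ℝ × ℝ, u.1 ^ 2 + u.2 ^ 2 = 1 ∧ ¬ IsStableDir U u) :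
    (∃ p : ℝ, 0 ≤ p ∧ p < 1 ∧ ∀ μ : Measure (Site → Bool), IsBernoulli p μ →
        μ {ω : Site → Bool | Percolates U (siteSet ω)} = 1) ∧
    critProb U < 1 := by
  obtain ⟨u, -, hu⟩ := hS
  obtain ⟨X, hXU, hX⟩ := exists_rule_subset_halfPlane hu
  have hcard : (1 : ℝ) ≤ X.card := by exact_mod_cast (hU.2 X hXU).1.card_pos
  have hperc : ∃ p : ℝ, 0 ≤ p ∧ p < 1 ∧ ∀ μ : Measure (Site → Bool), IsBernoulli p μ →
      μ {ω : Site → Bool | Percolates U (siteSet ω)} = 1 := by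
    refine ⟨1 - 1 / (2 * X.card), ?_, ?_, fun μ hμ => hμ.measure_percolates_eq_one hXU hX ?_⟩
    · rw [sub_nonneg, div_le_one (by positivity)]
      linarith
    · have : 0 < 1 / (2 * (X.card : ℝ)) := by positivity
      linarith
    · rw [← ENNReal.ofReal_natCast, ← ENNReal.ofReal_mul (by positivity), ENNReal.ofReal_lt_one]
      have : (X.card : ℝ) * (1 - (1 - 1 / (2 * X.card))) = 1 / 2 := by
        field_simp
        ring
      linarith
  refine ⟨hperc, ?_⟩
  obtain ⟨p, hp0, hp1, hp⟩ := hperc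
  exact lt_of_le_of_lt (csInf_le ⟨0, fun q hq => hq.1.1⟩ ⟨⟨hp0, hp1.le⟩, hp⟩) hp1
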